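/- (Theorem 2) Let ρ be a full-rank (positive definite) state on ℂ^d ⊗ ℂ^d with S_{A|B}(ρ) < 0, and let W = −log₂ ρ + I_d ⊗ log₂(ρ_B). Then W is Hermitian, Tr(W·ρ) < 0, and for every state σ on ℂ^d ⊗ ℂ^d with S_{A|B}(σ) ≥ 0 one has Tr(W·σ) ≥ 0; that is, W is a witness separating ρ from the set of states with non-negative conditional von Neumann entropy. -/

import Mathlib

open scoped Kronecker ComplexOrder
open Matrix

noncomputable section

/-- Base-2 matrix logarithm via the functional calculus: same eigenvectors, eigenvalues
replaced by their base-2 logarithms (junk value `0` on non-Hermitian matrices). -/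
def matLog2 {n : Type*} [Fintype n] [DecidableEq n] (M : Matrix n n ℂ) : Matrix n n ℂ :=
  if h : M.IsHermitian then
    (h.eigenvectorUnitary : Matrix n n ℂ) *
      Matrix.diagonal (fun i => (Real.logb 2 (h.eigenvalues i) : ℂ)) *
      (star (h.eigenvectorUnitary : Matrix n n ℂ))
  else 0

/-- von Neumann entropy `S(M) = −∑ λᵢ log₂ λᵢ` over the eigenvalues of `M`
(the convention `0 · log₂ 0 = 0` holds since `Real.logb 2 0 = 0`). -/
def vnEntropy {n : Type*} [Fintype n] [DecidableEq n] (M : Matrix n n ℂ) : ℝ :=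
  if h : M.IsHermitian then -∑ i, h.eigenvalues i * Real.logb 2 (h.eigenvalues i) else 0

/-- Partial trace over the first subsystem: `(ρ_B)_{k,l} = ∑ i, ρ_{(i,k),(i,l)}`. -/
def ptraceB {d : ℕ} (ρ : Matrix (Fin d × Fin d) (Fin d × Fin d) ℂ) : Matrix (Fin d) (Fin d) ℂ :=
  Matrix.of fun k l => ∑ i, ρ (i, k) (i, l)

/-- Partial trace over the second subsystem: `(ρ_A)_{i,j} = ∑ k, ρ_{(i,k),(j,k)}`. -/
def ptraceA {d : ℕ} (ρ : Matrix (Fin d × Fin d) (Fin d × Fin d) ℂ) : Matrix (Fin d) (Fin d) ℂ :=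
  Matrix.of fun i j => ∑ k, ρ (i, k) (j, k)

/-- Conditional von Neumann entropy `S_{A|B}(ρ) = S(ρ) − S(ρ_B)`. -/
def condEntropy {d : ℕ} (ρ : Matrix (Fin d × Fin d) (Fin d × Fin d) ℂ) : ℝ :=
  vnEntropy ρ - vnEntropy (ptraceB ρ)

/-- A state on `ℂ^d ⊗ ℂ^d`: a positive semidefinite matrix with trace 1. -/
def IsState {d : ℕ} (ρ : Matrix (Fin d × Fin d) (Fin d × Fin d) ℂ) : Prop :=
  ρ.PosSemidef ∧ ρ.trace = 1

open Filter Topology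

section Spectral

variable {n : Type*} [Fintype n] [DecidableEq n] {A B : Matrix n n ℂ}

/-- Squared moduli of the inner products between the eigenvectors of `A` and those of `B`. -/
def overlap (hA : A.IsHermitian) (hB : B.IsHermitian) (i j : n) : ℝ :=
  Complex.normSq ((star (hA.eigenvectorUnitary : Matrix n n ℂ) *
    (hB.eigenvectorUnitary : Matrix n n ℂ)) i j)

lemma sum_normSq_row_of_mul_star_eq_one {U : Matrix n n ℂ} (hU : U * star U = 1) (i : n) :
    ∑ j, Complex.normSq (U i j) = 1 := by
  have h := congrFun (congrFun hU i) i
  rw [Matrix.mul_apply] at h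
  simp only [Matrix.star_apply, Complex.star_def, Complex.mul_conj, one_apply_eq] at h
  exact_mod_cast h

lemma eigenvectorUnitary_mul_star (hA : A.IsHermitian) :
    (hA.eigenvectorUnitary : Matrix n n ℂ) * star (hA.eigenvectorUnitary : Matrix n n ℂ) = 1 :=
  Unitary.coe_mul_star_self hA.eigenvectorUnitary

lemma sum_overlap (hA : A.IsHermitian) (hB : B.IsHermitian) (i : n) :
    ∑ j, overlap hA hB i j = 1 := by
  refine sum_normSq_row_of_mul_star_eq_one ?_ i
  have h₁ := Unitary.coe_star_mul_self hA.eigenvectorUnitary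
  rw [star_mul, star_star, mul_assoc, ← mul_assoc _ (star _) _, eigenvectorUnitary_mul_star, one_mul, h₁]

lemma eq_eigenvectorUnitary_mul_diagonal (hA : A.IsHermitian) :
    A = (hA.eigenvectorUnitary : Matrix n n ℂ) *
      diagonal (fun i => (hA.eigenvalues i : ℂ)) *
      star (hA.eigenvectorUnitary : Matrix n n ℂ) := by
  conv_lhs => rw [hA.spectral_theorem, Unitary.conjStarAlgAut_apply]
  rfl

lemma trace_conj_diagonal_mul (U V : Matrix n n ℂ) (p q : n → ℝ) :
    ((V * diagonal (fun j => (q j : ℂ)) * star V *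
      (U * diagonal (fun i => (p i : ℂ)) * star U)).trace).re =
      ∑ i, ∑ j, Complex.normSq ((star U * V) i j) * (p i * q j) := by
  have h : (V * diagonal (fun j => (q j : ℂ)) * star V *
      (U * diagonal (fun i => (p i : ℂ)) * star U)).trace =
      ((star U * V) * diagonal (fun j => (q j : ℂ)) * star (star U * V) *
        diagonal (fun i => (p i : ℂ))).trace := by
    rw [← mul_assoc, trace_mul_comm, star_mul, star_star]
    simp only [mul_assoc]
  rw [h, trace, Complex.re_sum]
  refine Finset.sum_congr rfl fun i _ => ?_
  rw [diag_apply, mul_diagonal, mul_apply, Finset.sum_mul, Complex.re_sum]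
  refine Finset.sum_congr rfl fun j _ => ?_
  rw [mul_diagonal, star_apply, Complex.star_def, mul_right_comm ((star U * V) i j),
    Complex.mul_conj]
  norm_cast
  ring

lemma matLog2_isHermitian (A : Matrix n n ℂ) : (matLog2 A).IsHermitian := by
  unfold matLog2
  split_ifs with h
  · refine isHermitian_mul_mul_conjTranspose _ ?_
    exact isHermitian_diagonal_of_self_adjoint _ (by ext i; simp)
  · exact isHermitian_zero

lemma re_trace_matLog2_mul (hA : A.IsHermitian) (hB : B.IsHermitian) :
    ((matLog2 B * A).trace).re =
      ∑ i, ∑ j, overlap hA hB i j * (hA.eigenvalues i * Real.logb 2 (hB.eigenvalues j)) := by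
  conv_lhs => rw [eq_eigenvectorUnitary_mul_diagonal hA]
  rw [matLog2, dif_pos hB]
  exact trace_conj_diagonal_mul _ _ _ _

lemma re_trace_matLog2_mul_self (hA : A.IsHermitian) :
    ((matLog2 A * A).trace).re = -vnEntropy A := by
  rw [re_trace_matLog2_mul hA hA, vnEntropy, dif_pos hA, neg_neg]
  refine Finset.sum_congr rfl fun i _ => ?_
  simp only [overlap, Unitary.coe_star_mul_self, one_apply]
  simp

lemma re_trace_eq_sum_overlap (hA : A.IsHermitian) (hB : B.IsHermitian) :
    A.trace.re = ∑ i, ∑ j, overlap hA hB i j * hA.eigenvalues i := by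
  simp_rw [← Finset.sum_mul, sum_overlap, one_mul]
  rw [hA.trace_eq_sum_eigenvalues]
  simp

/-- The concave functional of `Z` whose supremum over `Z` is the quadratic form of the resolvent
at `-s` of the relative modular operator of `A` and `B`. -/
def resolventFunctional (s : ℝ) (A B Z : Matrix n n ℂ) : ℝ :=
  2 * ((Z * A).trace).re - s * ((Zᴴ * Z * A).trace).re - ((Z * Zᴴ * B).trace).re

lemma trace_mul_diagonal_re (M : Matrix n n ℂ) (p : n → ℝ) :
    ((M * diagonal (fun i => (p i : ℂ))).trace).re = ∑ i, (M i i).re * p i := by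
  simp [trace, mul_diagonal]

lemma resolventFunctional_conj {U V : Matrix n n ℂ} (hU : star U * U = 1) (hV : star V * V = 1)
    (s : ℝ) (p q : n → ℝ) (Y : Matrix n n ℂ) :
    resolventFunctional s (U * diagonal (fun i => (p i : ℂ)) * star U)
      (V * diagonal (fun j => (q j : ℂ)) * star V) (V * Y * star U) =
      ∑ i, ∑ j, (2 * (((star U * V) i j * Y j i).re * p i) -
        (s * p i + q j) * Complex.normSq (Y j i)) := by
  have h₁ : (V * Y * star U * (U * diagonal (fun i => (p i : ℂ)) * star U)).trace =
      ((star U * V) * Y * diagonal (fun i => (p i : ℂ))).trace := by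
    rw [← mul_assoc, trace_mul_comm]
    simp only [mul_assoc]
    rw [← mul_assoc (star U) U, hU, one_mul]
  have h₂ : ((V * Y * star U)ᴴ * (V * Y * star U) *
      (U * diagonal (fun i => (p i : ℂ)) * star U)).trace =
      (star Y * Y * diagonal (fun i => (p i : ℂ))).trace := by
    rw [← mul_assoc, trace_mul_comm, ← star_eq_conjTranspose, star_mul, star_mul, star_star]
    simp only [mul_assoc]
    rw [← mul_assoc (star U) U, hU, one_mul, ← mul_assoc (star V) V, hV, one_mul,
      ← mul_assoc (star U) U, hU, one_mul]
  have h₃ : (V * Y * star U * (V * Y * star U)ᴴ *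
      (V * diagonal (fun i => (q i : ℂ)) * star V)).trace =
      (Y * star Y * diagonal (fun i => (q i : ℂ))).trace := by
    rw [← mul_assoc, trace_mul_comm, ← star_eq_conjTranspose, star_mul, star_mul, star_star]
    simp only [mul_assoc]
    rw [← mul_assoc (star V) V, hV, one_mul, ← mul_assoc (star U) U, hU, one_mul,
      ← mul_assoc (star V) V, hV, one_mul]
  rw [resolventFunctional, h₁, h₂, h₃]
  simp_rw [trace_mul_diagonal_re]
  have e₁ : ∀ i, ((star U * V * Y) i i).re * p i =
      ∑ j, ((star U * V) i j * Y j i).re * p i := fun i => by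
    rw [mul_apply, Complex.re_sum, Finset.sum_mul]
  have e₂ : ∀ i, ((star Y * Y) i i).re * p i = ∑ j, Complex.normSq (Y j i) * p i := fun i => by
    rw [mul_apply, Complex.re_sum, Finset.sum_mul]
    refine Finset.sum_congr rfl fun j _ => ?_
    rw [star_apply, Complex.star_def, mul_comm (starRingEnd ℂ _), Complex.mul_conj,
      Complex.ofReal_re]
  have e₃ : ∀ j, ((Y * star Y) j j).re * q j = ∑ i, Complex.normSq (Y j i) * q j := fun j => by
    rw [mul_apply, Complex.re_sum, Finset.sum_mul]
    refine Finset.sum_congr rfl fun i _ => ?_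
    rw [star_apply, Complex.star_def, Complex.mul_conj, Complex.ofReal_re]
  simp_rw [e₁, e₂, e₃]
  rw [Finset.sum_comm (f := fun j i => Complex.normSq (Y j i) * q j)]
  simp_rw [Finset.mul_sum, ← Finset.sum_sub_distrib]
  refine Finset.sum_congr rfl fun i _ => Finset.sum_congr rfl fun j _ => ?_
  ring

/-- The supremum over `Z` of `resolventFunctional s A B Z`. -/
def resolventForm (s : ℝ) (hA : A.IsHermitian) (hB : B.IsHermitian) : ℝ :=
  ∑ i, ∑ j, overlap hA hB i j *
    (hA.eigenvalues i ^ 2 / (s * hA.eigenvalues i + hB.eigenvalues j))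

lemma complete_square (c y : ℂ) (p : ℝ) {r : ℝ} (hr : 0 < r) :
    2 * ((c * y).re * p) - r * Complex.normSq y ≤ Complex.normSq c * (p ^ 2 / r) := by
  rw [← mul_div_assoc, le_div_iff₀ hr]
  simp only [Complex.normSq_apply, Complex.mul_re]
  nlinarith [sq_nonneg (r * y.re - p * c.re), sq_nonneg (r * y.im + p * c.im)]

lemma complete_square_eq (c : ℂ) (p : ℝ) {r : ℝ} (hr : 0 < r) :
    2 * ((c * (starRingEnd ℂ c * ((p / r : ℝ) : ℂ))).re * p) -
      r * Complex.normSq (starRingEnd ℂ c * ((p / r : ℝ) : ℂ)) =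
      Complex.normSq c * (p ^ 2 / r) := by
  rw [← mul_assoc c, Complex.mul_conj, ← Complex.ofReal_mul, Complex.ofReal_re,
    Complex.normSq_mul, Complex.normSq_conj, Complex.normSq_ofReal]
  field_simp
  ring

lemma resolventFunctional_le {s : ℝ} (hs : 0 ≤ s) (hA : A.PosSemidef) (hB : B.PosDef)
    (Z : Matrix n n ℂ) :
    resolventFunctional s A B Z ≤ resolventForm s hA.1 hB.1 := by
  have hU := Unitary.coe_star_mul_self hA.1.eigenvectorUnitary
  have hV := Unitary.coe_star_mul_self hB.1.eigenvectorUnitary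
  have key := resolventFunctional_conj hU hV s hA.1.eigenvalues hB.1.eigenvalues
    (star (hB.1.eigenvectorUnitary : Matrix n n ℂ) * Z *
      (hA.1.eigenvectorUnitary : Matrix n n ℂ))
  rw [← eq_eigenvectorUnitary_mul_diagonal, ← eq_eigenvectorUnitary_mul_diagonal,
    ← mul_assoc, ← mul_assoc, eigenvectorUnitary_mul_star, one_mul, mul_assoc,
    eigenvectorUnitary_mul_star, mul_one] at key
  rw [key]
  refine Finset.sum_le_sum fun i _ => Finset.sum_le_sum fun j _ => complete_square _ _ _ ?_
  exact add_pos_of_nonneg_of_pos (mul_nonneg hs (hA.eigenvalues_nonneg i)) (hB.eigenvalues_pos j)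

lemma exists_resolventFunctional_eq {s : ℝ} (hs : 0 ≤ s) (hA : A.PosSemidef) (hB : B.PosDef) :
    ∃ Z, resolventFunctional s A B Z = resolventForm s hA.1 hB.1 := by
  have hU := Unitary.coe_star_mul_self hA.1.eigenvectorUnitary
  have hV := Unitary.coe_star_mul_self hB.1.eigenvectorUnitary
  have key := resolventFunctional_conj hU hV s hA.1.eigenvalues hB.1.eigenvalues
    (of fun j i => starRingEnd ℂ ((star (hA.1.eigenvectorUnitary : Matrix n n ℂ) *
      (hB.1.eigenvectorUnitary : Matrix n n ℂ)) i j) *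
      ((hA.1.eigenvalues i / (s * hA.1.eigenvalues i + hB.1.eigenvalues j) : ℝ) : ℂ))
  rw [← eq_eigenvectorUnitary_mul_diagonal, ← eq_eigenvectorUnitary_mul_diagonal] at key
  refine ⟨_, key.trans ?_⟩
  refine Finset.sum_congr rfl fun i _ => Finset.sum_congr rfl fun j _ => complete_square_eq _ _ ?_
  exact add_pos_of_nonneg_of_pos (mul_nonneg hs (hA.eigenvalues_nonneg i)) (hB.eigenvalues_pos j)

/-- The integral of `resolventForm s hA hB` over `s ∈ [0, T]`. -/
def integratedResolventForm (T : ℝ) (hA : A.IsHermitian) (hB : B.IsHermitian) : ℝ :=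
  ∑ i, ∑ j, overlap hA hB i j * (hA.eigenvalues i *
    (Real.log (T * hA.eigenvalues i + hB.eigenvalues j) - Real.log (hB.eigenvalues j)))

lemma integratedResolventForm_zero (hA : A.IsHermitian) (hB : B.IsHermitian) :
    integratedResolventForm 0 hA hB = 0 := by
  simp [integratedResolventForm]

lemma hasDerivAt_integratedResolventForm {T : ℝ} (hT : 0 ≤ T) (hA : A.PosSemidef)
    (hB : B.PosDef) :
    HasDerivAt (fun s => integratedResolventForm s hA.1 hB.1) (resolventForm T hA.1 hB.1) T := by
  refine HasDerivAt.fun_sum fun i _ => HasDerivAt.fun_sum fun j _ => HasDerivAt.const_mul _ ?_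
  have hpos : 0 < T * hA.1.eigenvalues i + hB.1.eigenvalues j :=
    add_pos_of_nonneg_of_pos (mul_nonneg hT (hA.eigenvalues_nonneg i)) (hB.eigenvalues_pos j)
  have h := (((((hasDerivAt_id' T).mul_const (hA.1.eigenvalues i)).add_const
    (hB.1.eigenvalues j)).log hpos.ne').sub_const
    (Real.log (hB.1.eigenvalues j))).const_mul (hA.1.eigenvalues i)
  convert h using 1
  ring

/-- The quantum relative entropy of `A` with respect to `B`, in natural units. -/
def relEntropy (hA : A.IsHermitian) (hB : B.IsHermitian) : ℝ :=
  ∑ i, ∑ j, overlap hA hB i j * (hA.eigenvalues i *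
    (Real.log (hA.eigenvalues i) - Real.log (hB.eigenvalues j)))

lemma relEntropy_eq (hA : A.IsHermitian) (hB : B.IsHermitian) :
    relEntropy hA hB = Real.log 2 * (-vnEntropy A - ((matLog2 B * A).trace).re) := by
  have h : -vnEntropy A = ∑ i, ∑ j, overlap hA hB i j *
      (hA.eigenvalues i * Real.logb 2 (hA.eigenvalues i)) := by
    simp_rw [← Finset.sum_mul, sum_overlap, one_mul]
    rw [vnEntropy, dif_pos hA, neg_neg]
  have h2 : Real.log 2 ≠ 0 := (Real.log_pos one_lt_two).ne'
  rw [h, re_trace_matLog2_mul hA hB, relEntropy]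
  simp_rw [← Finset.sum_sub_distrib, Finset.mul_sum, Real.logb]
  refine Finset.sum_congr rfl fun i _ => Finset.sum_congr rfl fun j _ => ?_
  field_simp

lemma tendsto_integratedResolventForm (hA : A.PosSemidef) (hB : B.PosDef) :
    Tendsto (fun T => integratedResolventForm T hA.1 hB.1 - A.trace.re * Real.log T) atTop
      (𝓝 (relEntropy hA.1 hB.1)) := by
  have h : Tendsto (fun T : ℝ => ∑ i, ∑ j, overlap hA.1 hB.1 i j * (hA.1.eigenvalues i *
      (Real.log (hA.1.eigenvalues i + hB.1.eigenvalues j / T) -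
        Real.log (hB.1.eigenvalues j)))) atTop (𝓝 (relEntropy hA.1 hB.1)) := by
    refine tendsto_finsetSum _ fun i _ => tendsto_finsetSum _ fun j _ =>
      Tendsto.const_mul _ ?_
    rcases eq_or_ne (hA.1.eigenvalues i) 0 with h0 | h0
    · simp [h0]
    · refine Tendsto.const_mul _ (Tendsto.sub_const ?_ _)
      refine Tendsto.log ?_ h0
      simpa using (tendsto_id.const_div_atTop (hB.1.eigenvalues j)).const_add
        (hA.1.eigenvalues i)
  refine h.congr' ?_
  filter_upwards [eventually_gt_atTop 0] with T hT
  rw [re_trace_eq_sum_overlap hA.1 hB.1, integratedResolventForm]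
  simp_rw [Finset.sum_mul, ← Finset.sum_sub_distrib]
  refine Finset.sum_congr rfl fun i _ => Finset.sum_congr rfl fun j _ => ?_
  have hpos : 0 < T * hA.1.eigenvalues i + hB.1.eigenvalues j :=
    add_pos_of_nonneg_of_pos (mul_nonneg hT.le (hA.eigenvalues_nonneg i)) (hB.eigenvalues_pos j)
  have e : hA.1.eigenvalues i + hB.1.eigenvalues j / T =
      (T * hA.1.eigenvalues i + hB.1.eigenvalues j) / T := by
    field_simp
  rw [e, Real.log_div hpos.ne' hT.ne']
  ring

end Spectral

section PartialTrace

variable {d : ℕ} {ρ σ : Matrix (Fin d × Fin d) (Fin d × Fin d) ℂ}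

lemma ptraceB_eq_sum_submatrix (ρ : Matrix (Fin d × Fin d) (Fin d × Fin d) ℂ) :
    ptraceB ρ = ∑ i, ρ.submatrix (Prod.mk i) (Prod.mk i) := by
  ext k l
  simp [ptraceB, Matrix.sum_apply]

lemma ptraceB_posSemidef (hρ : ρ.PosSemidef) : (ptraceB ρ).PosSemidef := by
  rw [ptraceB_eq_sum_submatrix]
  exact posSemidef_sum _ fun i _ => hρ.submatrix _

lemma ptraceB_posDef (hd : 0 < d) (hρ : ρ.PosDef) : (ptraceB ρ).PosDef := by
  rw [ptraceB_eq_sum_submatrix]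
  exact posDef_sum ⟨⟨0, hd⟩, Finset.mem_univ _⟩ fun i _ =>
    hρ.submatrix (Prod.mk_right_injective i)

lemma trace_one_kronecker_mul (X : Matrix (Fin d) (Fin d) ℂ)
    (σ : Matrix (Fin d × Fin d) (Fin d × Fin d) ℂ) :
    (((1 : Matrix (Fin d) (Fin d) ℂ) ⊗ₖ X) * σ).trace = (X * ptraceB σ).trace := by
  simp only [trace, diag_apply, mul_apply, Fintype.sum_prod_type, kroneckerMap_apply, ptraceB,
    of_apply, one_apply, ite_mul, one_mul, zero_mul, Finset.sum_ite_irrel,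
    Finset.sum_const_zero, Finset.sum_ite_eq, Finset.mem_univ, if_true, Finset.mul_sum]
  rw [Finset.sum_comm]
  exact Finset.sum_congr rfl fun k _ => Finset.sum_comm

lemma trace_ptraceB (σ : Matrix (Fin d × Fin d) (Fin d × Fin d) ℂ) :
    (ptraceB σ).trace = σ.trace := by
  simpa using (trace_one_kronecker_mul 1 σ).symm

lemma resolventFunctional_one_kronecker (s : ℝ)
    (σ ρ : Matrix (Fin d × Fin d) (Fin d × Fin d) ℂ) (X : Matrix (Fin d) (Fin d) ℂ) :
    resolventFunctional s σ ρ ((1 : Matrix (Fin d) (Fin d) ℂ) ⊗ₖ X) =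
      resolventFunctional s (ptraceB σ) (ptraceB ρ) X := by
  simp only [resolventFunctional, conjTranspose_kronecker, conjTranspose_one,
    ← mul_kronecker_mul, mul_one, trace_one_kronecker_mul]

lemma resolventForm_ptraceB_le (hd : 0 < d) {s : ℝ} (hs : 0 ≤ s) (hσ : σ.PosSemidef)
    (hρ : ρ.PosDef) :
    resolventForm s (ptraceB_posSemidef hσ).1 (ptraceB_posDef hd hρ).1 ≤
      resolventForm s hσ.1 hρ.1 := by
  obtain ⟨X, hX⟩ := exists_resolventFunctional_eq hs (ptraceB_posSemidef hσ)
    (ptraceB_posDef hd hρ)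
  rw [← hX, ← resolventFunctional_one_kronecker]
  exact resolventFunctional_le hs hσ hρ _

lemma integratedResolventForm_ptraceB_le (hd : 0 < d) {T : ℝ} (hT : 0 ≤ T)
    (hσ : σ.PosSemidef) (hρ : ρ.PosDef) :
    integratedResolventForm T (ptraceB_posSemidef hσ).1 (ptraceB_posDef hd hρ).1 ≤
      integratedResolventForm T hσ.1 hρ.1 := by
  have hderiv : ∀ s : ℝ, 0 ≤ s → HasDerivAt (fun t => integratedResolventForm t hσ.1 hρ.1 -
      integratedResolventForm t (ptraceB_posSemidef hσ).1 (ptraceB_posDef hd hρ).1) _ s :=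
    fun s hs => (hasDerivAt_integratedResolventForm hs hσ hρ).sub
      (hasDerivAt_integratedResolventForm hs (ptraceB_posSemidef hσ) (ptraceB_posDef hd hρ))
  have hmono := monotoneOn_of_deriv_nonneg (convex_Ici (0 : ℝ))
    (fun s hs => (hderiv s hs).continuousAt.continuousWithinAt)
    (fun s hs => (hderiv s (interior_subset hs)).differentiableAt.differentiableWithinAt)
    (fun s hs => by
      rw [(hderiv s (interior_subset hs)).deriv]
      exact sub_nonneg.2 (resolventForm_ptraceB_le hd (interior_subset hs) hσ hρ))
  have h := hmono (Set.mem_Ici.2 le_rfl) (Set.mem_Ici.2 hT) hT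
  simp only [integratedResolventForm_zero, sub_zero] at h
  exact sub_nonneg.1 h

/-- Monotonicity of the quantum relative entropy under the partial trace. -/
theorem relEntropy_ptraceB_le (hd : 0 < d) (hσ : σ.PosSemidef) (hρ : ρ.PosDef) :
    relEntropy (ptraceB_posSemidef hσ).1 (ptraceB_posDef hd hρ).1 ≤ relEntropy hσ.1 hρ.1 := by
  refine le_of_tendsto_of_tendsto
    (tendsto_integratedResolventForm (ptraceB_posSemidef hσ) (ptraceB_posDef hd hρ))
    (tendsto_integratedResolventForm hσ hρ) ?_
  filter_upwards [eventually_ge_atTop 0] with T hT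
  rw [trace_ptraceB]
  exact sub_le_sub_right (integratedResolventForm_ptraceB_le hd hT hσ hρ) _

lemma re_trace_witness_mul (ρ σ : Matrix (Fin d × Fin d) (Fin d × Fin d) ℂ) :
    (((-(matLog2 ρ) + (1 : Matrix (Fin d) (Fin d) ℂ) ⊗ₖ matLog2 (ptraceB ρ)) * σ).trace).re =
      -((matLog2 ρ * σ).trace).re + ((matLog2 (ptraceB ρ) * ptraceB σ).trace).re := by
  rw [add_mul, trace_add, trace_one_kronecker_mul, neg_mul, trace_neg, Complex.add_re,
    Complex.neg_re]

end PartialTrace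

/-- Theorem 2: for a full-rank state `ρ` with `S_{A|B}(ρ) < 0`, the operator
`W = −log₂ ρ + I ⊗ log₂ ρ_B` is a Hermitian witness: `Tr(W ρ) < 0` while `Tr(W σ) ≥ 0`
for every state `σ` with non-negative conditional entropy. -/
theorem witness_theorem {d : ℕ} (hd : 0 < d)
    (ρ : Matrix (Fin d × Fin d) (Fin d × Fin d) ℂ) (hρ : ρ.PosDef) (htr : ρ.trace = 1)
    (hneg : condEntropy ρ < 0) :
    (-(matLog2 ρ) + (1 : Matrix (Fin d) (Fin d) ℂ) ⊗ₖ matLog2 (ptraceB ρ)).IsHermitian ∧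
    (((-(matLog2 ρ) + (1 : Matrix (Fin d) (Fin d) ℂ) ⊗ₖ matLog2 (ptraceB ρ)) * ρ).trace).re
      < 0 ∧
    (∀ σ : Matrix (Fin d × Fin d) (Fin d × Fin d) ℂ, IsState σ → 0 ≤ condEntropy σ →
      0 ≤ (((-(matLog2 ρ) + (1 : Matrix (Fin d) (Fin d) ℂ) ⊗ₖ matLog2 (ptraceB ρ)) * σ).trace).re) := by
  refine ⟨(matLog2_isHermitian _).neg.add ?_, ?_, fun σ hσ hcond => ?_⟩
  · rw [IsHermitian, conjTranspose_kronecker, conjTranspose_one, (matLog2_isHermitian _).eq]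
  · rw [re_trace_witness_mul, re_trace_matLog2_mul_self hρ.1,
      re_trace_matLog2_mul_self (ptraceB_posDef hd hρ).1]
    unfold condEntropy at hneg
    linarith
  · have h := relEntropy_ptraceB_le hd hσ.1 hρ
    rw [relEntropy_eq, relEntropy_eq, mul_le_mul_iff_right₀ (Real.log_pos one_lt_two)] at h
    rw [re_trace_witness_mul]
    unfold condEntropy at hcond
    linarith
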